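/- Let d ≥ 1, β > 0, and let h ∈ (ℝ^d)^ℕ be a field whose sample means converge, m_n → m ∈ ℝ^d, and whose sample standard deviations converge, s_n → s ∈ (0,∞)^d. Then for every Borel set A ⊂ B_{2d}(0,1) of positive finite Lebesgue measure, limsup_{n→∞} (1/n) ln ∫_A (1 − ‖x‖² − ‖y‖²)^{−(d+1)} e^{n ψ_n^{β,h}(x,y)} dx dy ≤ sup_{(x,y) ∈ A} ψ^{β,h}(x,y). -/

import Mathlib

open MeasureTheory Filter Topology

noncomputable def ip {d : ℕ} (x y : Fin d → ℝ) : ℝ := ∑ j, x j * y j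

noncomputable def sampleMean (d : ℕ) (h : ℕ → Fin d → ℝ) (n : ℕ) : Fin d → ℝ :=
  fun j => (∑ i ∈ Finset.range n, h i j) / n

noncomputable def sampleStd (d : ℕ) (h : ℕ → Fin d → ℝ) (n : ℕ) : Fin d → ℝ :=
  fun j => Real.sqrt ((∑ i ∈ Finset.range n, (h i j) ^ 2) / n - (sampleMean d h n j) ^ 2)

/-- Membership in the open unit ball `B_{2d}(0,1) ⊂ ℝ^d × ℝ^d`. -/
def inBall (d : ℕ) (x y : Fin d → ℝ) : Prop := ip x x + ip y y < 1

def ballSet (d : ℕ) : Set ((Fin d → ℝ) × (Fin d → ℝ)) := {p | inBall d p.1 p.2}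

/-- The exponential tilting function with mean vector `m` and standard deviation vector `s`. -/
noncomputable def psi (d : ℕ) (β : ℝ) (m s : Fin d → ℝ) (x y : Fin d → ℝ) : ℝ :=
  β / 2 * ip x x + β * ip m x + β * ip s y + (d : ℝ) / 2 * Real.log (1 - ip x x - ip y y)

theorem abs_ip_le {d : ℕ} (a x : Fin d → ℝ) (hx : ip x x ≤ 1) : |ip a x| ≤ ∑ j, |a j| := by
  refine (Finset.abs_sum_le_sum_abs _ _).trans (Finset.sum_le_sum fun j _ => ?_)
  have hj : x j * x j ≤ 1 :=
    (Finset.single_le_sum (f := fun j => x j * x j) (fun i _ => mul_self_nonneg (x i))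
      (Finset.mem_univ j)).trans hx
  have hxj : |x j| ≤ 1 := abs_le_one_iff_mul_self_le_one.2 hj
  rw [abs_mul]
  exact mul_le_of_le_one_right (abs_nonneg _) hxj

theorem ip_self_nonneg {d : ℕ} (x : Fin d → ℝ) : 0 ≤ ip x x :=
  Finset.sum_nonneg fun j _ => mul_self_nonneg (x j)

theorem ip_sub_left {d : ℕ} (a b x : Fin d → ℝ) : ip (a - b) x = ip a x - ip b x := by
  simp [ip, sub_mul, Finset.sum_sub_distrib]

theorem measurable_one_sub_ip_sub_ip (d : ℕ) :
    Measurable fun p : (Fin d → ℝ) × (Fin d → ℝ) => 1 - ip p.1 p.1 - ip p.2 p.2 := by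
  refine Continuous.measurable ?_
  unfold ip; fun_prop

theorem measurable_psi (d : ℕ) (β : ℝ) (m s : Fin d → ℝ) :
    Measurable fun p : (Fin d → ℝ) × (Fin d → ℝ) => psi d β m s p.1 p.2 := by
  have h₁ : Continuous fun p : (Fin d → ℝ) × (Fin d → ℝ) =>
      β / 2 * ip p.1 p.1 + β * ip m p.1 + β * ip s p.2 := by
    unfold ip; fun_prop
  exact h₁.measurable.add
    ((Real.measurable_log.comp (measurable_one_sub_ip_sub_ip d)).const_mul _)

theorem abs_psi_sub_psi_le {d : ℕ} {β : ℝ} (hβ : 0 < β) (m s m' s' : Fin d → ℝ)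
    {x y : Fin d → ℝ} (hxy : inBall d x y) :
    |psi d β m' s' x y - psi d β m s x y|
      ≤ β * (∑ j, |m' j - m j| + ∑ j, |s' j - s j|) := by
  have hx := ip_self_nonneg x
  have hy := ip_self_nonneg y
  unfold inBall at hxy
  have h₁ := abs_ip_le (m' - m) x (by linarith)
  have h₂ := abs_ip_le (s' - s) y (by linarith)
  have h₃ : psi d β m' s' x y - psi d β m s x y = β * (ip (m' - m) x + ip (s' - s) y) := by
    rw [ip_sub_left, ip_sub_left]; unfold psi; ring
  rw [h₃, abs_mul, abs_of_pos hβ]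
  exact mul_le_mul_of_nonneg_left ((abs_add_le _ _).trans (add_le_add h₁ h₂)) hβ.le

/-- On the unit ball the tilting function differs from its logarithmic part by a bounded amount. -/
theorem abs_psi_sub_log_le {d : ℕ} {β : ℝ} (hβ : 0 < β) (m s : Fin d → ℝ)
    {x y : Fin d → ℝ} (hxy : inBall d x y) :
    |psi d β m s x y - (d : ℝ) / 2 * Real.log (1 - ip x x - ip y y)|
      ≤ β * (1 + ∑ j, |m j| + ∑ j, |s j|) := by
  have hx := ip_self_nonneg x
  have hy := ip_self_nonneg y
  unfold inBall at hxy
  have h₁ := abs_ip_le m x (by linarith)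
  have h₂ := abs_ip_le s y (by linarith)
  have h₃ : psi d β m s x y - (d : ℝ) / 2 * Real.log (1 - ip x x - ip y y)
      = β * (ip x x / 2 + ip m x + ip s y) := by
    unfold psi; ring
  rw [h₃, abs_mul, abs_of_pos hβ]
  refine mul_le_mul_of_nonneg_left ?_ hβ.le
  rw [abs_le] at *
  constructor <;> linarith [h₁.1, h₁.2, h₂.1, h₂.2]

theorem exp_four_mul_psi_div_le {d : ℕ} (hd : 1 ≤ d) {β : ℝ} (hβ : 0 < β) (m s : Fin d → ℝ)
    {x y : Fin d → ℝ} (hxy : inBall d x y) :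
    Real.exp (4 * psi d β m s x y) / (1 - ip x x - ip y y) ^ (d + 1)
      ≤ Real.exp (4 * (β * (1 + ∑ j, |m j| + ∑ j, |s j|))) := by
  have hx := ip_self_nonneg x
  have hy := ip_self_nonneg y
  have hB := (abs_le.1 (abs_psi_sub_log_le hβ m s hxy)).2
  unfold inBall at hxy
  have hw : 0 < 1 - ip x x - ip y y := by linarith
  have hlog : Real.log (1 - ip x x - ip y y) ≤ 0 := Real.log_nonpos hw.le (by linarith)
  have hpow : (1 - ip x x - ip y y) ^ (d + 1)
      = Real.exp ((d + 1 : ℝ) * Real.log (1 - ip x x - ip y y)) := by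
    rw [← Real.rpow_natCast, Real.rpow_def_of_pos hw]; push_cast; ring_nf
  rw [hpow, ← Real.exp_sub, Real.exp_le_exp]
  have hd' : (1 : ℝ) ≤ d := by exact_mod_cast hd
  nlinarith [mul_nonneg (sub_nonneg.2 hd') (neg_nonneg.2 hlog)]

/-- A set of positive measure in the open ball charges some smaller closed ball. -/
theorem exists_pos_measure_le_one_sub {d : ℕ} {A : Set ((Fin d → ℝ) × (Fin d → ℝ))}
    (hAsub : A ⊆ ballSet d) (hpos : 0 < volume A) :
    ∃ δ : ℝ, 0 < δ ∧ 0 < volume (A ∩ {p | δ ≤ 1 - ip p.1 p.1 - ip p.2 p.2}) := by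
  by_contra! hcon
  refine hpos.ne' (measure_mono_null (t := ⋃ k : ℕ, A ∩ {p | 1 / ((k : ℝ) + 1) ≤
    1 - ip p.1 p.1 - ip p.2 p.2}) (fun p hp => ?_)
    (measure_iUnion_null fun k => le_antisymm (hcon _ (by positivity)) bot_le))
  have hb : ip p.1 p.1 + ip p.2 p.2 < 1 := hAsub hp
  obtain ⟨k, hk⟩ := exists_nat_one_div_lt (show 0 < 1 - ip p.1 p.1 - ip p.2 p.2 by linarith)
  exact Set.mem_iUnion.2 ⟨k, hp, hk.le⟩

/-- Laplace-method upper bound: for any Borel A ⊆ B_{2d}(0,1) of positive finite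
Lebesgue measure, limsup (1/n) ln ∫_A (1-‖x‖²-‖y‖²)^{-(d+1)} e^{n ψₙ} ≤ sup_A ψ. -/
theorem stmt3 (d : ℕ) (hd : 1 ≤ d) (β : ℝ) (hβ : 0 < β) (h : ℕ → Fin d → ℝ)
    (m s : Fin d → ℝ)
    (hm : Tendsto (sampleMean d h) atTop (𝓝 m))
    (hs : Tendsto (sampleStd d h) atTop (𝓝 s))
    (hspos : ∀ j, 0 < s j)
    (A : Set ((Fin d → ℝ) × (Fin d → ℝ))) (hA : MeasurableSet A)
    (hAsub : A ⊆ ballSet d) (hpos : 0 < volume A) (hfin : volume A < ⊤) :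
    Filter.limsup (fun n : ℕ =>
        (n : ℝ)⁻¹ * Real.log (∫ p in A,
          Real.exp (n * psi d β (sampleMean d h n) (sampleStd d h n) p.1 p.2) /
            (1 - ip p.1 p.1 - ip p.2 p.2) ^ (d + 1) ∂volume)) atTop
      ≤ sSup ((fun p : (Fin d → ℝ) × (Fin d → ℝ) => psi d β m s p.1 p.2) '' A) := by
  set B : ℝ := β * (1 + ∑ j, |m j| + ∑ j, |s j|)
  set S : ℝ := sSup ((fun p : (Fin d → ℝ) × (Fin d → ℝ) => psi d β m s p.1 p.2) '' A)
  set e : ℕ → ℝ := fun n => β * (∑ j, |sampleMean d h n j - m j| + ∑ j, |sampleStd d h n j - s j|)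
  set f : ℕ → (Fin d → ℝ) × (Fin d → ℝ) → ℝ := fun n p =>
    Real.exp (n * psi d β (sampleMean d h n) (sampleStd d h n) p.1 p.2) /
      (1 - ip p.1 p.1 - ip p.2 p.2) ^ (d + 1)
  have he : Tendsto e atTop (𝓝 0) := by
    have key : ∀ (u : ℕ → Fin d → ℝ) (v : Fin d → ℝ), Tendsto u atTop (𝓝 v) →
        Tendsto (fun n => ∑ j, |u n j - v j|) atTop (𝓝 0) := fun u v huv => by
      have := tendsto_finsetSum Finset.univ fun j _ =>
        (((tendsto_pi_nhds.1 huv j).sub_const (v j)).abs)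
      simpa using this
    simpa using ((key _ _ hm).add (key _ _ hs)).const_mul β
  have hw : ∀ p ∈ A, 0 < 1 - ip p.1 p.1 - ip p.2 p.2 := fun p hp => by
    have hb : ip p.1 p.1 + ip p.2 p.2 < 1 := hAsub hp
    linarith
  have hw' : ∀ p ∈ A, 1 - ip p.1 p.1 - ip p.2 p.2 ≤ 1 := fun p _ => by
    linarith [ip_self_nonneg p.1, ip_self_nonneg p.2]
  have hclose : ∀ n, ∀ p ∈ A, |psi d β (sampleMean d h n) (sampleStd d h n) p.1 p.2 -
      psi d β m s p.1 p.2| ≤ e n := fun n p hp => abs_psi_sub_psi_le hβ _ _ _ _ (hAsub hp)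
  have hbdd : BddAbove ((fun p : (Fin d → ℝ) × (Fin d → ℝ) => psi d β m s p.1 p.2) '' A) := by
    refine ⟨B, ?_⟩
    rintro _ ⟨p, hp, rfl⟩
    have h₁ := (abs_le.1 (abs_psi_sub_log_le hβ m s (hAsub hp))).2
    have h₂ : (d : ℝ) / 2 * Real.log (1 - ip p.1 p.1 - ip p.2 p.2) ≤ 0 :=
      mul_nonpos_of_nonneg_of_nonpos (by positivity)
        (Real.log_nonpos (hw p hp).le (hw' p hp))
    change psi d β m s p.1 p.2 ≤ B
    linarith
  have hle : ∀ p ∈ A, psi d β m s p.1 p.2 ≤ S := fun p hp => le_csSup hbdd ⟨p, hp, rfl⟩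
  have hfpos : ∀ n, ∀ p ∈ A, 0 < f n p := fun n p hp =>
    div_pos (Real.exp_pos _) (pow_pos (hw p hp) _)
  have hupper : ∀ n : ℕ, 4 ≤ n → ∀ p ∈ A,
      f n p ≤ Real.exp (n * e n + 4 * B + (n - 4) * S) := by
    intro n hn p hp
    have hn' : (4 : ℝ) ≤ n := by exact_mod_cast hn
    have h₁ := (abs_le.1 (hclose n p hp)).2
    have h₂ := exp_four_mul_psi_div_le hd hβ m s (hAsub hp)
    have h₃ : Real.exp (n * psi d β (sampleMean d h n) (sampleStd d h n) p.1 p.2) ≤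
        Real.exp (n * e n + (n - 4) * S) * Real.exp (4 * psi d β m s p.1 p.2) := by
      rw [← Real.exp_add, Real.exp_le_exp]
      nlinarith [mul_nonneg (sub_nonneg.2 hn') (sub_nonneg.2 (hle p hp))]
    calc f n p ≤ Real.exp (n * e n + (n - 4) * S) * Real.exp (4 * psi d β m s p.1 p.2) /
          (1 - ip p.1 p.1 - ip p.2 p.2) ^ (d + 1) :=
          div_le_div_of_nonneg_right h₃ (pow_pos (hw p hp) _).le
      _ = Real.exp (n * e n + (n - 4) * S) * (Real.exp (4 * psi d β m s p.1 p.2) /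
          (1 - ip p.1 p.1 - ip p.2 p.2) ^ (d + 1)) := mul_div_assoc _ _ _
      _ ≤ Real.exp (n * e n + (n - 4) * S) * Real.exp (4 * B) := by gcongr
      _ = _ := by rw [← Real.exp_add]; ring_nf
  have hfm : ∀ n, Measurable (f n) := fun n =>
    ((measurable_psi d β _ _).const_mul _).exp.div ((measurable_one_sub_ip_sub_ip d).pow_const _)
  have hint : ∀ n : ℕ, 4 ≤ n → IntegrableOn (f n) A := fun n hn =>
    Measure.integrableOn_of_bounded (M := Real.exp (n * e n + 4 * B + (n - 4) * S)) hfin.ne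
      (hfm n).aestronglyMeasurable ((ae_restrict_iff' hA).2 (ae_of_all _ fun p hp => by
        rw [Real.norm_of_nonneg (hfpos n p hp).le]
        exact hupper n hn p hp))
  obtain ⟨δ, hδ, hAδ⟩ := exists_pos_measure_le_one_sub hAsub hpos
  set D := A ∩ {p | δ ≤ 1 - ip p.1 p.1 - ip p.2 p.2}
  have hDA : D ⊆ A := Set.inter_subset_left
  have hD : MeasurableSet D :=
    hA.inter (measurableSet_le measurable_const (measurable_one_sub_ip_sub_ip d))
  have hDfin : volume D < ⊤ := (measure_mono hDA).trans_lt hfin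
  have hDpos : 0 < volume.real D := ENNReal.toReal_pos hAδ.ne' hDfin.ne
  have hApos : 0 < volume.real A := ENNReal.toReal_pos hpos.ne' hfin.ne
  set c : ℝ := (d : ℝ) / 2 * Real.log δ - B with hc
  have hlower : ∀ n : ℕ, ∀ p ∈ D, Real.exp (n * (c - e n)) ≤ f n p := by
    intro n p hp
    have hpA := hDA hp
    have h₁ := (abs_le.1 (hclose n p hpA)).1
    have h₂ : -B ≤ _ := (abs_le.1 (abs_psi_sub_log_le hβ m s (hAsub hpA))).1
    have h₃ : (d : ℝ) / 2 * Real.log δ ≤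
        (d : ℝ) / 2 * Real.log (1 - ip p.1 p.1 - ip p.2 p.2) :=
      mul_le_mul_of_nonneg_left (Real.log_le_log hδ hp.2) (by positivity)
    refine le_trans (Real.exp_le_exp.2 (mul_le_mul_of_nonneg_left ?_ n.cast_nonneg))
      (le_div_self (Real.exp_pos _).le (pow_pos (hw p hpA) _)
        (pow_le_one₀ (hw p hpA).le (hw' p hpA)))
    linarith [hc]
  have hIle : ∀ n : ℕ, 4 ≤ n →
      ∫ p in A, f n p ≤ volume.real A * Real.exp (n * e n + 4 * B + (n - 4) * S) := by
    intro n hn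
    have := setIntegral_mono_on (hint n hn) (integrableOn_const hfin.ne) hA (hupper n hn)
    simpa using this
  have hleI : ∀ n : ℕ, 4 ≤ n →
      volume.real D * Real.exp (n * (c - e n)) ≤ ∫ p in A, f n p := by
    intro n hn
    have h₁ := setIntegral_mono_on (integrableOn_const hDfin.ne) ((hint n hn).mono_set hDA) hD
      (hlower n)
    have h₂ : ∫ p in D, f n p ≤ ∫ p in A, f n p :=
      setIntegral_mono_set (hint n hn)
        ((ae_restrict_iff' hA).2 (ae_of_all _ fun p hp => (hfpos n p hp).le))
        (LE.le.eventuallyLE hDA)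
    refine le_trans ?_ h₂
    simpa using h₁
  have hinv : Tendsto (fun n : ℕ => (n : ℝ)⁻¹) atTop (𝓝 0) := tendsto_inv_atTop_nhds_zero_nat
  have hv : Tendsto (fun n : ℕ => (n : ℝ)⁻¹ * (Real.log (volume.real A) + 4 * B - 4 * S) +
      e n + S) atTop (𝓝 S) := by
    simpa using ((hinv.mul_const _).add he).add_const S
  have hl : Tendsto (fun n : ℕ => (n : ℝ)⁻¹ * Real.log (volume.real D) + (c - e n)) atTop
      (𝓝 c) := by
    simpa using (hinv.mul_const (Real.log (volume.real D))).add (he.const_sub c)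
  have hub : ∀ᶠ n : ℕ in atTop, (n : ℝ)⁻¹ * Real.log (∫ p in A, f n p) ≤
      (n : ℝ)⁻¹ * (Real.log (volume.real A) + 4 * B - 4 * S) + e n + S := by
    filter_upwards [eventually_ge_atTop 4] with n hn
    have hn0 : (0 : ℝ) < n := by exact_mod_cast (by omega : 0 < n)
    have h₁ := Real.log_le_log ((by positivity : (0 : ℝ) < _).trans_le (hleI n hn)) (hIle n hn)
    rw [Real.log_mul hApos.ne' (Real.exp_pos _).ne', Real.log_exp] at h₁
    refine (mul_le_mul_of_nonneg_left h₁ (inv_pos.2 hn0).le).trans_eq ?_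
    field_simp
    ring
  have hlb : ∀ᶠ n : ℕ in atTop, (n : ℝ)⁻¹ * Real.log (volume.real D) + (c - e n) ≤
      (n : ℝ)⁻¹ * Real.log (∫ p in A, f n p) := by
    filter_upwards [eventually_ge_atTop 4] with n hn
    have hn0 : (0 : ℝ) < n := by exact_mod_cast (by omega : 0 < n)
    have h₁ := Real.log_le_log (by positivity) (hleI n hn)
    rw [Real.log_mul hDpos.ne' (Real.exp_pos _).ne', Real.log_exp] at h₁
    refine Eq.trans_le ?_ (mul_le_mul_of_nonneg_left h₁ (inv_pos.2 hn0).le)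
    field_simp
  exact (limsup_le_limsup hub (hl.isBoundedUnder_ge.mono_ge hlb).isCoboundedUnder_le
    hv.isBoundedUnder_le).trans_eq hv.limsup_eq
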